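/- Let [E₀,E₁] and [F₀,F₁] be interpolation couples of finite-dimensional Banach spaces and 0 < θ < 1. Define d_θ[M₀,M₁] to be the norm of the identity L(ℓ₂,[M₀,M₁]_θ) → [L(ℓ₂,M₀), L(ℓ₂,M₁)]_θ. Then the norm of the natural embedding Γ₂([E₀,E₁]_θ', [F₀,F₁]_θ) → [Γ₂(E₀',F₀), Γ₂(E₁',F₁)]_θ is at most d_θ[E₀,E₁]·d_θ[F₀,F₁]. -/

import Mathlib

open Complex MeasureTheory Finset

noncomputable section

namespace Paper

/-- The closed unit strip in the complex plane. -/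
def Strip : Set ℂ := {z : ℂ | 0 ≤ z.re ∧ z.re ≤ 1}

/-- The open unit strip in the complex plane. -/
def OStrip : Set ℂ := {z : ℂ | 0 < z.re ∧ z.re < 1}

/-- `N` is a norm on the complex vector space `V`. -/
def IsNormC {V : Type*} [AddCommGroup V] [Module ℂ V] (N : V → ℝ) : Prop :=
  (∀ x, 0 ≤ N x) ∧ (∀ x, N x = 0 → x = 0) ∧
  (∀ (c : ℂ) (x), N (c • x) = ‖c‖ * N x) ∧ (∀ x y, N (x + y) ≤ N x + N y)

/-- `N` is a lattice norm on `ℝⁿ`. -/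
def IsLatticeNorm {n : ℕ} (N : (Fin n → ℝ) → ℝ) : Prop :=
  (∀ x, 0 ≤ N x) ∧ (∀ x, N x = 0 → x = 0) ∧
  (∀ (c : ℝ) (x), N (c • x) = |c| * N x) ∧ (∀ x y, N (x + y) ≤ N x + N y) ∧
  (∀ x y, (∀ i, |x i| ≤ |y i|) → N x ≤ N y)

/-- The `r`-th power `X^r` of a lattice norm: `‖x‖_{X^r} = ‖ |x|^{1/r} ‖_X^r`. -/
def powNorm {n : ℕ} (r : ℝ) (N : (Fin n → ℝ) → ℝ) (x : Fin n → ℝ) : ℝ :=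
  (N fun i => |x i| ^ (1 / r)) ^ r

/-- `N` is `p`-convex with constant `C`. -/
def ConvexWith {n : ℕ} (p C : ℝ) (N : (Fin n → ℝ) → ℝ) : Prop :=
  ∀ (m : ℕ) (x : Fin m → Fin n → ℝ),
    N (fun j => (∑ i, |x i j| ^ p) ^ (1 / p)) ≤ C * (∑ i, N (x i) ^ p) ^ (1 / p)

/-- `N` is `p`-concave with constant `C`. -/
def ConcaveWith {n : ℕ} (p C : ℝ) (N : (Fin n → ℝ) → ℝ) : Prop :=
  ∀ (m : ℕ) (x : Fin m → Fin n → ℝ),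
    (∑ i, N (x i) ^ p) ^ (1 / p) ≤ C * N (fun j => (∑ i, |x i j| ^ p) ^ (1 / p))

/-- The dual lattice norm on `ℝⁿ`. -/
def dualNR {n : ℕ} (N : (Fin n → ℝ) → ℝ) (y : Fin n → ℝ) : ℝ :=
  sSup {r : ℝ | ∃ x, N x ≤ 1 ∧ r = |∑ i, x i * y i|}

/-- The Calderón product norm `X₀^{1-θ}X₁^θ` on `ℝⁿ`. -/
def calNorm {n : ℕ} (θ : ℝ) (N₀ N₁ : (Fin n → ℝ) → ℝ) (f : Fin n → ℝ) : ℝ :=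
  sInf {c : ℝ | ∃ g h : Fin n → ℝ, (∀ i, |f i| = |g i| ^ (1 - θ) * |h i| ^ θ) ∧
    c = N₀ g ^ (1 - θ) * N₁ h ^ θ}

/-- The complex interpolation norm `[N₀,N₁]_θ`, computed via analytic functions
of finite type `z ↦ ∑ φᵢ(z) • vᵢ` on the strip (which, by density, gives the
complex interpolation norm on the intersection for couples with dense intersection). -/
def interpN {D : Type*} [AddCommGroup D] [Module ℂ D]
    (θ : ℝ) (N₀ N₁ : D → ℝ) (x : D) : ℝ :=
  sInf {c : ℝ | ∃ (m : ℕ) (φ : Fin m → ℂ → ℂ) (v : Fin m → D),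
    (∀ i, ContinuousOn (φ i) Strip) ∧
    (∀ i, DifferentiableOn ℂ (φ i) OStrip) ∧
    (∀ i, ∃ B : ℝ, ∀ z ∈ Strip, ‖φ i z‖ ≤ B) ∧
    (∑ i, φ i (θ : ℂ) • v i) = x ∧
    (∀ t : ℝ, N₀ (∑ i, φ i (Complex.I * t) • v i) ≤ c) ∧
    (∀ t : ℝ, N₁ (∑ i, φ i (1 + Complex.I * t) • v i) ≤ c)}

/-- Operator "norm" of a map with respect to given norm functions. -/
def opN {X Y : Type*} (NX : X → ℝ) (NY : Y → ℝ) (T : X → Y) : ℝ :=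
  sSup {r : ℝ | ∃ x, NX x ≤ 1 ∧ r = NY (T x)}

/-- The Hilbert space `ℓ₂`. -/
abbrev Hilb := lp (fun _ : ℕ => ℂ) 2

def hilbNorm (x : Hilb) : ℝ := ‖x‖

/-- `d_θ[M₀,M₁]`: the norm of the identity
`L(ℓ₂,[M₀,M₁]_θ) → [L(ℓ₂,M₀),L(ℓ₂,M₁)]_θ`. -/
def dTheta {V : Type*} [NormedAddCommGroup V] [NormedSpace ℂ V]
    (θ : ℝ) (N₀ N₁ : V → ℝ) : ℝ :=
  sSup {r : ℝ | ∃ T : Hilb →L[ℂ] V,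
    opN hilbNorm (interpN θ N₀ N₁) ⇑T ≤ 1 ∧
    r = interpN θ (fun S : Hilb →L[ℂ] V => opN hilbNorm N₀ ⇑S)
        (fun S : Hilb →L[ℂ] V => opN hilbNorm N₁ ⇑S) T}

/-- Rademacher average `(2^{-m} ∑_ε ‖∑ ±xᵢ‖²)`. -/
def radAvg {V : Type*} [AddCommGroup V] (N : V → ℝ) {m : ℕ} (x : Fin m → V) : ℝ :=
  ((2 : ℝ) ^ m)⁻¹ * ∑ ε : Fin m → Bool, N (∑ i, if ε i then x i else -x i) ^ 2

/-- `N` has (Rademacher) type 2 with constant `C`. -/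
def Type2With {V : Type*} [AddCommGroup V] (N : V → ℝ) (C : ℝ) : Prop :=
  ∀ (m : ℕ) (x : Fin m → V), Real.sqrt (radAvg N x) ≤ C * Real.sqrt (∑ i, N (x i) ^ 2)

/-- `N` has (Rademacher) cotype 2 with constant `C`. -/
def Cotype2With {V : Type*} [AddCommGroup V] (N : V → ℝ) (C : ℝ) : Prop :=
  ∀ (m : ℕ) (x : Fin m → V), Real.sqrt (∑ i, N (x i) ^ 2) ≤ C * Real.sqrt (radAvg N x)

/-- The injective tensor norm of two norm functions. -/
def injN {V W : Type*} [AddCommGroup V] [Module ℂ V] [AddCommGroup W] [Module ℂ W]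
    (NV : V → ℝ) (NW : W → ℝ) (z : TensorProduct ℂ V W) : ℝ :=
  sSup {r : ℝ | ∃ (φ : V →ₗ[ℂ] ℂ) (ψ : W →ₗ[ℂ] ℂ),
    (∀ x, ‖φ x‖ ≤ NV x) ∧ (∀ y, ‖ψ y‖ ≤ NW y) ∧
    r = ‖TensorProduct.lift (((LinearMap.mul ℂ ℂ).comp φ).compl₂ ψ) z‖}

/-- Dual norm on linear functionals. -/
def dualNC {V : Type*} [AddCommGroup V] [Module ℂ V] (N : V → ℝ) (φ : V →ₗ[ℂ] ℂ) : ℝ :=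
  sSup {r : ℝ | ∃ x, N x ≤ 1 ∧ r = ‖φ x‖}

/-- The space of bounded linear functionals (dual space of the completion). -/
def BddDual {V : Type*} [AddCommGroup V] [Module ℂ V] (N : V → ℝ) :
    Submodule ℂ (V →ₗ[ℂ] ℂ) where
  carrier := {φ | ∃ c : ℝ, ∀ x, ‖φ x‖ ≤ c * N x}
  zero_mem' := ⟨0, by simp⟩
  add_mem' := by
    rintro φ ψ ⟨c, hc⟩ ⟨d, hd⟩
    exact ⟨c + d, fun x => by
      have h1 := hc x; have h2 := hd x
      calc ‖(φ + ψ) x‖ = ‖φ x + ψ x‖ := by simp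
        _ ≤ ‖φ x‖ + ‖ψ x‖ := norm_add_le _ _
        _ ≤ (c + d) * N x := by rw [add_mul]; exact add_le_add h1 h2⟩
  smul_mem' := by
    rintro a φ ⟨c, hc⟩
    exact ⟨‖a‖ * c, fun x => by
      have : ‖(a • φ) x‖ = ‖a‖ * ‖φ x‖ := by simp [norm_smul]
      rw [this, mul_assoc]
      exact mul_le_mul_of_nonneg_left (hc x) (norm_nonneg a)⟩

/-- Strictly simple functions with values in `V`: the span of
`v`-valued indicators of finite-measure measurable sets. -/
def SimpleSub {Ω : Type*} [MeasurableSpace Ω] (μ : Measure Ω)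
    (V : Type*) [AddCommGroup V] [Module ℂ V] : Submodule ℂ (Ω → V) :=
  Submodule.span ℂ {f | ∃ (s : Set Ω) (v : V), MeasurableSet s ∧ μ s < ⊤ ∧
    f = s.indicator fun _ => v}

/-- A Banach function space over a measure `μ`, with `K`-valued functions. -/
structure BFS (Ω : Type*) [MeasurableSpace Ω] (μ : Measure Ω) (K : Type*) [RCLike K] where
  mem : (Ω → K) → Prop
  nrm : (Ω → K) → ℝ
  mem_zero : mem 0
  mem_add : ∀ f g, mem f → mem g → mem (f + g)
  mem_smul : ∀ (c : K) (f), mem f → mem (c • f)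
  mem_meas : ∀ f, mem f → AEStronglyMeasurable f μ
  ideal : ∀ f g, AEStronglyMeasurable f μ → mem g →
    (∀ᵐ ω ∂μ, ‖f ω‖ ≤ ‖g ω‖) → mem f ∧ nrm f ≤ nrm g
  nrm_nonneg : ∀ f, 0 ≤ nrm f
  nrm_eq_zero : ∀ f, mem f → nrm f = 0 → f =ᵐ[μ] 0
  nrm_add : ∀ f g, mem f → mem g → nrm (f + g) ≤ nrm f + nrm g
  nrm_smul : ∀ (c : K) (f), nrm (c • f) = ‖c‖ * nrm f
  mem_indicator : ∀ s : Set Ω, MeasurableSet s → μ s < ⊤ →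
    mem (s.indicator fun _ => 1)
  complete : ∀ f : ℕ → Ω → K, (∀ k, mem (f k)) →
    (∀ ε : ℝ, 0 < ε → ∃ N : ℕ, ∀ p q, N ≤ p → N ≤ q → nrm (f p - f q) < ε) →
    ∃ g, mem g ∧ ∀ ε : ℝ, 0 < ε → ∃ N : ℕ, ∀ p, N ≤ p → nrm (f p - g) < ε

variable {Ω : Type*} [MeasurableSpace Ω] {μ : Measure Ω} {K : Type*} [RCLike K]

/-- `X` is `r`-convex with constant `C`. -/
def BFS.RConvexWith (X : BFS Ω μ K) (r C : ℝ) : Prop :=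
  ∀ (m : ℕ) (f : Fin m → Ω → K), (∀ i, X.mem (f i)) →
    X.mem (fun ω => ((((∑ i, ‖f i ω‖ ^ r) ^ (1 / r) : ℝ) : K))) ∧
    X.nrm (fun ω => ((((∑ i, ‖f i ω‖ ^ r) ^ (1 / r) : ℝ) : K))) ≤
      C * (∑ i, X.nrm (f i) ^ r) ^ (1 / r)

/-- `X` is `r`-concave with constant `C`. -/
def BFS.RConcaveWith (X : BFS Ω μ K) (r C : ℝ) : Prop :=
  ∀ (m : ℕ) (f : Fin m → Ω → K), (∀ i, X.mem (f i)) →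
    (∑ i, X.nrm (f i) ^ r) ^ (1 / r) ≤
      C * X.nrm (fun ω => ((((∑ i, ‖f i ω‖ ^ r) ^ (1 / r) : ℝ) : K)))

/-- The `γ₂`-norm (factorization through `ℓ₂`) with respect to norm functions. -/
def gamma2 {V W : Type*} [NormedAddCommGroup V] [NormedSpace ℂ V]
    [NormedAddCommGroup W] [NormedSpace ℂ W]
    (NV : V → ℝ) (NW : W → ℝ) (T : V →L[ℂ] W) : ℝ :=
  sInf {c : ℝ | ∃ (S : V →L[ℂ] Hilb) (R : Hilb →L[ℂ] W), R.comp S = T ∧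
    c = opN NV hilbNorm ⇑S * opN hilbNorm NW ⇑R}

/-- A copy of `V` carrying the norm `N`. -/
def NormCopy {V : Type*} [AddCommGroup V] [Module ℂ V] (N : V → ℝ) (_h : IsNormC N) : Type _ := V

section NormCopy

variable {V : Type*} [AddCommGroup V] [Module ℂ V] {N : V → ℝ} (h : IsNormC N)

instance : AddCommGroup (NormCopy N h) := inferInstanceAs (AddCommGroup V)

instance : Module ℂ (NormCopy N h) := inferInstanceAs (Module ℂ V)

instance : Norm (NormCopy N h) := ⟨N⟩

theorem IsNormC.map_zero (h : IsNormC N) : N 0 = 0 := by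
  simpa using h.2.2.1 0 0

theorem NormCopy.core : NormedSpace.Core ℂ (NormCopy N h) where
  norm_nonneg := h.1
  norm_smul := h.2.2.1
  norm_triangle := h.2.2.2
  norm_eq_zero_iff x := ⟨h.2.1 x, by rintro rfl; exact h.map_zero⟩

instance : NormedAddCommGroup (NormCopy N h) := NormedAddCommGroup.ofCore (NormCopy.core h)

instance : NormedSpace ℂ (NormCopy N h) := NormedSpace.ofCore (NormCopy.core h)

/-- The identity map onto the copy of `V` normed by `N`. -/
def NormCopy.equiv : V ≃ₗ[ℂ] NormCopy N h := LinearEquiv.refl ℂ V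

theorem NormCopy.norm_equiv (x : V) : ‖NormCopy.equiv h x‖ = N x := rfl

/-- Hahn–Banach: every vector is normed by a linear functional. -/
theorem IsNormC.exists_norming (h : IsNormC N) (x : V) :
    ∃ φ : V →ₗ[ℂ] ℂ, (∀ y, ‖φ y‖ ≤ N y) ∧ φ x = N x := by
  obtain ⟨g, hg, hx⟩ := exists_dual_vector'' ℂ (NormCopy.equiv h x)
  refine ⟨(g : NormCopy N h →ₗ[ℂ] ℂ) ∘ₗ (NormCopy.equiv h).toLinearMap, fun y => ?_, ?_⟩
  · have := g.le_of_opNorm_le hg (NormCopy.equiv h y)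
    simpa [NormCopy.norm_equiv] using this
  · simpa [NormCopy.norm_equiv] using hx

end NormCopy

section Equivalence

variable {V : Type*} [NormedAddCommGroup V] [NormedSpace ℂ V]

theorem isNormC_norm : IsNormC (fun x : V => ‖x‖) :=
  ⟨norm_nonneg, fun _ => norm_eq_zero.1, norm_smul, norm_add_le⟩

theorem isNormC_hilbNorm : IsNormC hilbNorm := isNormC_norm

variable [FiniteDimensional ℂ V] {N : V → ℝ}

theorem IsNormC.le_norm (h : IsNormC N) : ∃ C : ℝ, 0 < C ∧ ∀ x, N x ≤ C * ‖x‖ := by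
  obtain ⟨C, hC, hle⟩ :=
    (LinearMap.toContinuousLinearMap (NormCopy.equiv h).toLinearMap).bound
  exact ⟨C, hC, hle⟩

theorem IsNormC.norm_le (h : IsNormC N) : ∃ C : ℝ, 0 < C ∧ ∀ x, ‖x‖ ≤ C * N x := by
  have : FiniteDimensional ℂ (NormCopy N h) := inferInstanceAs (FiniteDimensional ℂ V)
  obtain ⟨C, hC, hle⟩ :=
    (LinearMap.toContinuousLinearMap (NormCopy.equiv h).symm.toLinearMap).bound
  exact ⟨C, hC, hle⟩

end Equivalence

section OpN

variable {X Y : Type*} {NX : X → ℝ} {NY : Y → ℝ} {T : X → Y}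

theorem opN_nonneg (hY : ∀ y, 0 ≤ NY y) : 0 ≤ opN NX NY T :=
  Real.sSup_nonneg (by rintro _ ⟨x, -, rfl⟩; exact hY _)

theorem opN_le {c : ℝ} (hc : 0 ≤ c) (h : ∀ x, NX x ≤ 1 → NY (T x) ≤ c) : opN NX NY T ≤ c :=
  Real.sSup_le (by rintro _ ⟨x, hx, rfl⟩; exact h x hx) hc

theorem le_opN_of_bound {c : ℝ} (h : ∀ x, NX x ≤ 1 → NY (T x) ≤ c) {x : X} (hx : NX x ≤ 1) :
    NY (T x) ≤ opN NX NY T :=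
  le_csSup ⟨c, by rintro _ ⟨y, hy, rfl⟩; exact h y hy⟩ ⟨x, hx, rfl⟩

variable [AddCommGroup X] [Module ℂ X] [AddCommGroup Y] [Module ℂ Y]

theorem le_opN_mul (hX : IsNormC NX) (hY : IsNormC NY) (L : X →ₗ[ℂ] Y) {c : ℝ}
    (h : ∀ x, NY (L x) ≤ c * NX x) (x : X) : NY (L x) ≤ opN NX NY L * NX x := by
  by_cases hx : NX x = 0
  · rw [hX.2.1 x hx]
    simp [hX.map_zero, hY.map_zero]
  have hpos : 0 < NX x := lt_of_le_of_ne (hX.1 x) (Ne.symm hx)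
  have hb : ∀ y, NX y ≤ 1 → NY (L y) ≤ |c| := fun y hy =>
    (h y).trans <| (mul_le_mul_of_nonneg_right (le_abs_self c) (hX.1 y)).trans
      (mul_le_of_le_one_right (abs_nonneg c) hy)
  have key := le_opN_of_bound (T := L) hb (x := ((NX x : ℂ)⁻¹) • x) (by
    rw [hX.2.2.1]; simp [abs_of_pos hpos, hx])
  rw [map_smul, hY.2.2.1] at key
  simp only [norm_inv, Complex.norm_real, Real.norm_eq_abs, abs_of_pos hpos] at key
  rwa [inv_mul_le_iff₀ hpos, mul_comm] at key

end OpN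

section Interp

variable {D : Type*} [AddCommGroup D] [Module ℂ D] {θ : ℝ} {N₀ N₁ : D → ℝ}

/-- The constant `c` is attained by an analytic family of finite type through `x`. -/
def InterpBound (θ : ℝ) (N₀ N₁ : D → ℝ) (ι : Type*) [Fintype ι] (x : D) (c : ℝ) : Prop :=
  ∃ (φ : ι → ℂ → ℂ) (v : ι → D),
    (∀ i, ContinuousOn (φ i) Strip) ∧
    (∀ i, DifferentiableOn ℂ (φ i) OStrip) ∧
    (∀ i, ∃ B : ℝ, ∀ z ∈ Strip, ‖φ i z‖ ≤ B) ∧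
    (∑ i, φ i (θ : ℂ) • v i) = x ∧
    (∀ t : ℝ, N₀ (∑ i, φ i (Complex.I * t) • v i) ≤ c) ∧
    (∀ t : ℝ, N₁ (∑ i, φ i (1 + Complex.I * t) • v i) ≤ c)

theorem InterpBound.toFin {ι : Type*} [Fintype ι] {x : D} {c : ℝ}
    (h : InterpBound θ N₀ N₁ ι x c) : InterpBound θ N₀ N₁ (Fin (Fintype.card ι)) x c := by
  obtain ⟨φ, v, h1, h2, h3, h4, h5, h6⟩ := h
  let e := (Fintype.equivFin ι).symm
  have hs : ∀ z, ∑ i, φ (e i) z • v (e i) = ∑ i, φ i z • v i := fun z =>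
    e.sum_comp fun i => φ i z • v i
  exact ⟨fun i => φ (e i), fun i => v (e i), fun i => h1 _, fun i => h2 _, fun i => h3 _,
    (hs _).trans h4, fun t => by rw [hs]; exact h5 t, fun t => by rw [hs]; exact h6 t⟩

theorem InterpBound.nonneg (h₀ : ∀ x, 0 ≤ N₀ x) {ι : Type*} [Fintype ι] {x : D} {c : ℝ}
    (h : InterpBound θ N₀ N₁ ι x c) : 0 ≤ c := by
  obtain ⟨φ, v, -, -, -, -, h5, -⟩ := h
  exact (h₀ _).trans (h5 0)

theorem interpN_le (h₀ : ∀ x, 0 ≤ N₀ x) {ι : Type*} [Fintype ι] {x : D} {c : ℝ}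
    (h : InterpBound θ N₀ N₁ ι x c) : interpN θ N₀ N₁ x ≤ c :=
  csInf_le ⟨0, by rintro _ ⟨m, hm⟩; exact InterpBound.nonneg h₀ hm⟩ ⟨_, h.toFin⟩

theorem interpN_nonneg (h₀ : ∀ x, 0 ≤ N₀ x) (x : D) : 0 ≤ interpN θ N₀ N₁ x :=
  Real.sInf_nonneg (by rintro _ ⟨m, hm⟩; exact InterpBound.nonneg h₀ hm)

theorem interpBound_const (x : D) :
    InterpBound θ N₀ N₁ (Fin 1) x (max (N₀ x) (N₁ x)) :=
  ⟨fun _ _ => 1, fun _ => x, fun _ => continuousOn_const, fun _ => differentiableOn_const _,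
    fun _ => ⟨1, by simp⟩, by simp, by simp, by simp⟩

theorem interpN_le_max (h₀ : ∀ x, 0 ≤ N₀ x) (x : D) :
    interpN θ N₀ N₁ x ≤ max (N₀ x) (N₁ x) :=
  interpN_le h₀ (interpBound_const x)

theorem exists_interpBound {x : D} {a : ℝ} (h : interpN θ N₀ N₁ x < a) :
    ∃ m : ℕ, ∃ c < a, InterpBound θ N₀ N₁ (Fin m) x c := by
  have hne : {c : ℝ | ∃ m : ℕ, InterpBound θ N₀ N₁ (Fin m) x c}.Nonempty :=
    ⟨_, 1, interpBound_const x⟩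
  obtain ⟨c, ⟨m, hm⟩, hc⟩ := exists_lt_of_csInf_lt hne h
  exact ⟨m, c, hc, hm⟩

theorem InterpBound.smul {a : ℂ} (h₀ : ∀ x, N₀ (a • x) ≤ ‖a‖ * N₀ x)
    (h₁ : ∀ x, N₁ (a • x) ≤ ‖a‖ * N₁ x) {ι : Type*} [Fintype ι] {x : D} {c : ℝ}
    (h : InterpBound θ N₀ N₁ ι x c) : InterpBound θ N₀ N₁ ι (a • x) (‖a‖ * c) := by
  obtain ⟨φ, v, h1, h2, h3, h4, h5, h6⟩ := h
  have hs : ∀ z, ∑ i, φ i z • a • v i = a • ∑ i, φ i z • v i := fun z => by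
    rw [Finset.smul_sum]
    exact Finset.sum_congr rfl fun i _ => smul_comm _ _ _
  refine ⟨φ, fun i => a • v i, h1, h2, h3, by rw [hs, h4], fun t => ?_, fun t => ?_⟩
  · rw [hs]
    exact (h₀ _).trans (mul_le_mul_of_nonneg_left (h5 t) (norm_nonneg a))
  · rw [hs]
    exact (h₁ _).trans (mul_le_mul_of_nonneg_left (h6 t) (norm_nonneg a))

theorem InterpBound.add (h₀ : ∀ x y, N₀ (x + y) ≤ N₀ x + N₀ y)
    (h₁ : ∀ x y, N₁ (x + y) ≤ N₁ x + N₁ y) {ι κ : Type*} [Fintype ι] [Fintype κ] {x y : D}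
    {c d : ℝ} (h : InterpBound θ N₀ N₁ ι x c) (h' : InterpBound θ N₀ N₁ κ y d) :
    InterpBound θ N₀ N₁ (ι ⊕ κ) (x + y) (c + d) := by
  obtain ⟨φ, v, h1, h2, h3, h4, h5, h6⟩ := h
  obtain ⟨ψ, w, k1, k2, k3, k4, k5, k6⟩ := h'
  refine ⟨Sum.elim φ ψ, Sum.elim v w, by simp [h1, k1], by simp [h2, k2], ?_, ?_, ?_, ?_⟩
  · rintro (i | i)
    exacts [h3 i, k3 i]
  · simp [Fintype.sum_sum_type, h4, k4]
  · intro t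
    simpa [Fintype.sum_sum_type] using (h₀ _ _).trans (add_le_add (h5 t) (k5 t))
  · intro t
    simpa [Fintype.sum_sum_type] using (h₁ _ _).trans (add_le_add (h6 t) (k6 t))

/-- The three lines theorem for analytic functions bounded on the strip. -/
theorem norm_le_of_strip {f : ℂ → ℂ} {B c : ℝ} (hθ : 0 ≤ θ) (hθ1 : θ ≤ 1)
    (hc : ContinuousOn f Strip) (hd : DifferentiableOn ℂ f OStrip)
    (hB : ∀ z ∈ Strip, ‖f z‖ ≤ B) (h0 : ∀ t : ℝ, ‖f (Complex.I * t)‖ ≤ c)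
    (h1 : ∀ t : ℝ, ‖f (1 + Complex.I * t)‖ ≤ c) : ‖f θ‖ ≤ c := by
  have hclosed : IsClosed Strip :=
    (isClosed_le continuous_const Complex.continuous_re).inter
      (isClosed_le Complex.continuous_re continuous_const)
  have hsub : closure (Complex.re ⁻¹' Set.Ioo 0 1) ⊆ Strip :=
    closure_minimal (fun z hz => ⟨hz.1.le, hz.2.le⟩) hclosed
  have hdc : DiffContOnCl ℂ f (Complex.re ⁻¹' Set.Ioo 0 1) := ⟨hd, hc.mono hsub⟩
  refine PhragmenLindelof.vertical_strip hdc ?_ ?_ ?_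
    (by simpa using hθ) (by simpa using hθ1)
  · refine ⟨0, by simpa using Real.pi_pos, 0, ?_⟩
    refine Asymptotics.IsBigO.of_bound B ?_
    refine Filter.Eventually.filter_mono inf_le_right ?_
    refine Filter.eventually_principal.2 fun z hz => ?_
    simpa using hB z ⟨hz.1.le, hz.2.le⟩
  · intro z hz
    have : z = Complex.I * z.im := by apply Complex.ext <;> simp [hz]
    rw [this]
    exact h0 _
  · intro z hz
    have : z = 1 + Complex.I * z.im := by apply Complex.ext <;> simp [hz]
    rw [this]
    exact h1 _

theorem InterpBound.norm_apply_le (hθ : 0 ≤ θ) (hθ1 : θ ≤ 1) {ι : Type*} [Fintype ι] {x : D}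
    {c : ℝ} (h : InterpBound θ N₀ N₁ ι x c) {K : ℝ} (hK : 0 ≤ K) (L : D →ₗ[ℂ] ℂ)
    (h₀ : ∀ y, ‖L y‖ ≤ K * N₀ y) (h₁ : ∀ y, ‖L y‖ ≤ K * N₁ y) : ‖L x‖ ≤ K * c := by
  obtain ⟨φ, v, h1, h2, h3, rfl, h5, h6⟩ := h
  choose B hB using h3
  have hs : ∀ z, L (∑ i, φ i z • v i) = ∑ i, φ i z * L (v i) := fun z => by simp
  rw [hs]
  refine norm_le_of_strip (f := fun z => ∑ i, φ i z * L (v i)) (B := ∑ i, B i * ‖L (v i)‖)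
    hθ hθ1 ?_ ?_ ?_ ?_ ?_
  · exact continuousOn_finsetSum _ fun i _ => (h1 i).mul continuousOn_const
  · exact DifferentiableOn.fun_sum fun i _ => (h2 i).mul_const _
  · intro z hz
    refine norm_sum_le_of_le _ fun i _ => ?_
    rw [norm_mul]
    exact mul_le_mul_of_nonneg_right (hB i z hz) (norm_nonneg _)
  · intro t
    rw [← hs]
    exact (h₀ _).trans (mul_le_mul_of_nonneg_left (h5 t) hK)
  · intro t
    rw [← hs]
    exact (h₁ _).trans (mul_le_mul_of_nonneg_left (h6 t) hK)

theorem interpN_add_le (h₀ : IsNormC N₀) (h₁ : IsNormC N₁) (x y : D) :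
    interpN θ N₀ N₁ (x + y) ≤ interpN θ N₀ N₁ x + interpN θ N₀ N₁ y := by
  refine le_of_forall_pos_le_add fun ε hε => ?_
  obtain ⟨_, c, hc, hx⟩ := exists_interpBound (lt_add_of_pos_right (interpN θ N₀ N₁ x)
    (half_pos hε))
  obtain ⟨_, d, hd, hy⟩ := exists_interpBound (lt_add_of_pos_right (interpN θ N₀ N₁ y)
    (half_pos hε))
  have := interpN_le h₀.1 (hx.add h₀.2.2.2 h₁.2.2.2 hy)
  linarith

theorem interpN_smul_le {a : ℂ} (hn : ∀ x, 0 ≤ N₀ x) (h₀ : ∀ x, N₀ (a • x) ≤ ‖a‖ * N₀ x)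
    (h₁ : ∀ x, N₁ (a • x) ≤ ‖a‖ * N₁ x) (x : D) :
    interpN θ N₀ N₁ (a • x) ≤ ‖a‖ * interpN θ N₀ N₁ x := by
  refine le_of_forall_pos_le_add fun ε hε => ?_
  have hpos : 0 < ‖a‖ + 1 := by positivity
  obtain ⟨_, c, hc, hx⟩ := exists_interpBound (lt_add_of_pos_right (interpN θ N₀ N₁ x)
    (div_pos hε hpos))
  calc interpN θ N₀ N₁ (a • x) ≤ ‖a‖ * c := interpN_le hn (hx.smul h₀ h₁)
    _ ≤ ‖a‖ * (interpN θ N₀ N₁ x + ε / (‖a‖ + 1)) :=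
        mul_le_mul_of_nonneg_left hc.le (norm_nonneg a)
    _ = ‖a‖ * interpN θ N₀ N₁ x + ‖a‖ * (ε / (‖a‖ + 1)) := mul_add _ _ _
    _ ≤ ‖a‖ * interpN θ N₀ N₁ x + (‖a‖ + 1) * (ε / (‖a‖ + 1)) := by gcongr; linarith
    _ = ‖a‖ * interpN θ N₀ N₁ x + ε := by rw [mul_div_cancel₀ _ hpos.ne']

end Interp

theorem dTheta_nonneg {V : Type*} [NormedAddCommGroup V] [NormedSpace ℂ V] {θ : ℝ}
    {N₀ N₁ : V → ℝ} (h₀ : IsNormC N₀) : 0 ≤ dTheta θ N₀ N₁ :=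
  Real.sSup_nonneg (by rintro _ ⟨T, -, rfl⟩; exact interpN_nonneg (fun _ => opN_nonneg h₀.1) _)

section FiniteDimensional

variable {V : Type*} [NormedAddCommGroup V] [NormedSpace ℂ V] [FiniteDimensional ℂ V]
  {θ : ℝ} {N N₀ N₁ : V → ℝ}

theorem norm_le_interpN (hθ : 0 ≤ θ) (hθ1 : θ ≤ 1) (h₀ : IsNormC N₀) (h₁ : IsNormC N₁) :
    ∃ K : ℝ, 0 < K ∧ ∀ x, ‖x‖ ≤ K * interpN θ N₀ N₁ x := by
  obtain ⟨K₀, hK₀, hle₀⟩ := h₀.norm_le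
  obtain ⟨K₁, hK₁, hle₁⟩ := h₁.norm_le
  have hK : 0 < max K₀ K₁ := lt_max_of_lt_left hK₀
  refine ⟨max K₀ K₁, hK, fun x => ?_⟩
  obtain ⟨L, hL, hLx⟩ := (isNormC_norm (V := V)).exists_norming x
  rw [← div_le_iff₀' hK]
  refine le_csInf ⟨_, 1, interpBound_const x⟩ ?_
  rintro c ⟨m, hc⟩
  rw [div_le_iff₀' hK]
  have := InterpBound.norm_apply_le hθ hθ1 hc hK.le L
    (fun y => (hL y).trans <| (hle₀ y).trans
      (mul_le_mul_of_nonneg_right (le_max_left _ _) (h₀.1 y)))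
    (fun y => (hL y).trans <| (hle₁ y).trans
      (mul_le_mul_of_nonneg_right (le_max_right _ _) (h₁.1 y)))
  simpa [hLx] using this

theorem isNormC_interpN (hθ : 0 ≤ θ) (hθ1 : θ ≤ 1) (h₀ : IsNormC N₀) (h₁ : IsNormC N₁) :
    IsNormC (interpN θ N₀ N₁) := by
  have hle : ∀ (a : ℂ) (x : V), interpN θ N₀ N₁ (a • x) ≤ ‖a‖ * interpN θ N₀ N₁ x :=
    fun a x => interpN_smul_le h₀.1 (fun y => (h₀.2.2.1 a y).le) (fun y => (h₁.2.2.1 a y).le) x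
  have hzero : ∀ x : V, interpN θ N₀ N₁ x = 0 → x = 0 := fun x hx => by
    obtain ⟨K, -, hK⟩ := norm_le_interpN hθ hθ1 h₀ h₁
    simpa [hx] using hK x
  refine ⟨interpN_nonneg h₀.1, hzero, fun a x => (hle a x).antisymm ?_,
    interpN_add_le h₀ h₁⟩
  by_cases ha : a = 0
  · simpa [ha] using interpN_nonneg h₀.1 (0 : V)
  · have := hle a⁻¹ (a • x)
    rwa [inv_smul_smul₀ ha, norm_inv, ← div_eq_inv_mul, le_div_iff₀' (norm_pos_iff.2 ha)] at this

theorem hilb_le_opN (h : IsNormC N) (u : Hilb →L[ℂ] V) (x : Hilb) :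
    N (u x) ≤ opN hilbNorm N u * ‖x‖ := by
  obtain ⟨C, hC, hle⟩ := h.le_norm
  refine le_opN_mul isNormC_hilbNorm h (u : Hilb →ₗ[ℂ] V) (c := C * ‖u‖) (fun y => ?_) x
  rw [mul_assoc]
  exact (hle _).trans (mul_le_mul_of_nonneg_left (u.le_opNorm y) hC.le)

theorem functional_le_opN (h : IsNormC N) (φ : V →L[ℂ] ℂ) (x : V) :
    ‖φ x‖ ≤ opN N (fun c : ℂ => ‖c‖) φ * N x := by
  obtain ⟨C, hC, hle⟩ := h.norm_le
  refine le_opN_mul h isNormC_norm (φ : V →ₗ[ℂ] ℂ) (c := ‖φ‖ * C) (fun y => ?_) x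
  rw [mul_assoc]
  exact (φ.le_opNorm y).trans (mul_le_mul_of_nonneg_left (hle y) (norm_nonneg φ))

theorem opN_hilb_smul_le (h : IsNormC N) (a : ℂ) (u : Hilb →L[ℂ] V) :
    opN hilbNorm N ⇑(a • u) ≤ ‖a‖ * opN hilbNorm N u := by
  refine opN_le (mul_nonneg (norm_nonneg a) (opN_nonneg h.1)) fun x hx => ?_
  rw [_root_.smul_apply, h.2.2.1]
  refine mul_le_mul_of_nonneg_left ((hilb_le_opN h u x).trans ?_) (norm_nonneg a)
  exact mul_le_of_le_one_right (opN_nonneg h.1) hx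

theorem interpN_le_dTheta (hθ : 0 ≤ θ) (hθ1 : θ ≤ 1) (h₀ : IsNormC N₀) (h₁ : IsNormC N₁)
    {u : Hilb →L[ℂ] V} (hu : opN hilbNorm (interpN θ N₀ N₁) u ≤ 1) :
    interpN θ (fun S : Hilb →L[ℂ] V => opN hilbNorm N₀ S)
      (fun S : Hilb →L[ℂ] V => opN hilbNorm N₁ S) u ≤ dTheta θ N₀ N₁ := by
  obtain ⟨K, hK, hle⟩ := norm_le_interpN hθ hθ1 h₀ h₁
  obtain ⟨C₀, hC₀, hle₀⟩ := h₀.le_norm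
  obtain ⟨C₁, hC₁, hle₁⟩ := h₁.le_norm
  refine le_csSup ⟨max (C₀ * K) (C₁ * K), ?_⟩ ⟨u, hu, rfl⟩
  rintro _ ⟨T, hT, rfl⟩
  have hb : ∀ x, hilbNorm x ≤ 1 → ‖T x‖ ≤ K := fun x hx => (hle _).trans <| by
    have := hilb_le_opN (isNormC_interpN hθ hθ1 h₀ h₁) T x
    exact mul_le_of_le_one_right hK.le
      (this.trans (mul_le_one₀ hT (norm_nonneg x) hx))
  refine (interpN_le_max (fun _ => opN_nonneg h₀.1) T).trans (max_le_max ?_ ?_)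
  · exact opN_le (by positivity) fun x hx =>
      (hle₀ _).trans (mul_le_mul_of_nonneg_left (hb x hx) hC₀.le)
  · exact opN_le (by positivity) fun x hx =>
      (hle₁ _).trans (mul_le_mul_of_nonneg_left (hb x hx) hC₁.le)

/-- The defining estimate of `dTheta`, for operators of arbitrary norm. -/
theorem interpN_le_dTheta_mul (hθ : 0 ≤ θ) (hθ1 : θ ≤ 1) (h₀ : IsNormC N₀) (h₁ : IsNormC N₁)
    (u : Hilb →L[ℂ] V) :
    interpN θ (fun S : Hilb →L[ℂ] V => opN hilbNorm N₀ S)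
      (fun S : Hilb →L[ℂ] V => opN hilbNorm N₁ S) u ≤
      dTheta θ N₀ N₁ * opN hilbNorm (interpN θ N₀ N₁) u := by
  have hN := isNormC_interpN hθ hθ1 h₀ h₁
  have hscale : ∀ s : ℝ, opN hilbNorm (interpN θ N₀ N₁) u < s →
      interpN θ (fun S : Hilb →L[ℂ] V => opN hilbNorm N₀ S)
        (fun S : Hilb →L[ℂ] V => opN hilbNorm N₁ S) u ≤ dTheta θ N₀ N₁ * s := by
    intro s hs
    have hpos : 0 < s := (opN_nonneg hN.1).trans_lt hs
    have hsC : (s : ℂ) ≠ 0 := by exact_mod_cast hpos.ne'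
    have hnorm : ‖(s : ℂ)‖ = s := by simp [abs_of_pos hpos]
    have h1 : opN hilbNorm (interpN θ N₀ N₁) ⇑((s : ℂ)⁻¹ • u) ≤ 1 := by
      refine (opN_hilb_smul_le hN _ u).trans ?_
      rw [norm_inv, hnorm, inv_mul_le_iff₀ hpos, mul_one]
      exact hs.le
    have h2 := interpN_le_dTheta hθ hθ1 h₀ h₁ h1
    have h3 := interpN_smul_le (θ := θ) (a := (s : ℂ))
      (N₀ := fun S : Hilb →L[ℂ] V => opN hilbNorm N₀ S)
      (N₁ := fun S : Hilb →L[ℂ] V => opN hilbNorm N₁ S) (fun _ => opN_nonneg h₀.1)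
      (opN_hilb_smul_le h₀ _) (opN_hilb_smul_le h₁ _) ((s : ℂ)⁻¹ • u)
    rw [smul_inv_smul₀ hsC, hnorm] at h3
    rw [mul_comm]
    exact h3.trans (mul_le_mul_of_nonneg_left h2 hpos.le)
  refine ge_of_tendsto (f := fun s => dTheta θ N₀ N₁ * s)
    (x := nhdsWithin (opN hilbNorm (interpN θ N₀ N₁) u) (Set.Ioi _)) ?_
    (Filter.eventually_of_mem self_mem_nhdsWithin hscale)
  exact ((continuous_const.mul continuous_id).tendsto _).mono_left nhdsWithin_le_nhds

end FiniteDimensional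

section Transpose

theorem hilb_inner_star (x y : Hilb) : inner ℂ (star x) (star y) = inner ℂ y x := by
  simp [lp.inner_eq_tsum, mul_comm]

theorem hilb_ext_inner_star {x y : Hilb} (h : ∀ k : Hilb, inner ℂ (star k) x = inner ℂ (star k) y) :
    x = y :=
  ext_inner_left ℂ fun k => by simpa using h (star k)

/-- The bilinear identification of the dual of `ℓ₂` with `ℓ₂`. -/
def hilbRiesz : (Hilb →L[ℂ] ℂ) →ₗ[ℂ] Hilb where
  toFun ψ := star ((InnerProductSpace.toDual ℂ Hilb).symm ψ)
  map_add' ψ χ := by simp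
  map_smul' a ψ := by
    rw [LinearIsometryEquiv.map_smulₛₗ, star_smul]
    simp

theorem norm_hilbRiesz (ψ : Hilb →L[ℂ] ℂ) : ‖hilbRiesz ψ‖ = ‖ψ‖ := by
  simp [hilbRiesz]

theorem inner_star_hilbRiesz (ψ : Hilb →L[ℂ] ℂ) (k : Hilb) :
    inner ℂ (star k) (hilbRiesz ψ) = ψ k := by
  simp [hilbRiesz, hilb_inner_star]

variable {V : Type*} [NormedAddCommGroup V] [NormedSpace ℂ V]

/-- The transpose of an operator `ℓ₂ → V`, as an operator `V' → ℓ₂`. -/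
def transposeHilb : (Hilb →L[ℂ] V) →ₗ[ℂ] ((V →L[ℂ] ℂ) →L[ℂ] Hilb) where
  toFun u := LinearMap.mkContinuous
    { toFun := fun φ => hilbRiesz (φ.comp u)
      map_add' := fun φ ψ => by simp [ContinuousLinearMap.add_comp]
      map_smul' := fun a φ => by simp [ContinuousLinearMap.smul_comp] } ‖u‖ fun φ => by
        simpa [norm_hilbRiesz, mul_comm] using φ.opNorm_comp_le u
  map_add' u v := by ext1 φ; simp [ContinuousLinearMap.comp_add]
  map_smul' a u := by ext1 φ; simp

theorem transposeHilb_apply (u : Hilb →L[ℂ] V) (φ : V →L[ℂ] ℂ) :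
    transposeHilb u φ = hilbRiesz (φ.comp u) := rfl

theorem opN_transposeHilb_le [FiniteDimensional ℂ V] {N : V → ℝ} (h : IsNormC N)
    (u : Hilb →L[ℂ] V) :
    opN (fun φ : V →L[ℂ] ℂ => opN N (fun c : ℂ => ‖c‖) φ) hilbNorm (transposeHilb u) ≤
      opN hilbNorm N u := by
  refine opN_le (opN_nonneg h.1) fun φ hφ => ?_
  rw [hilbNorm, transposeHilb_apply, norm_hilbRiesz]
  refine ContinuousLinearMap.opNorm_le_bound _ (opN_nonneg h.1) fun x => ?_
  refine (functional_le_opN h φ (u x)).trans ?_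
  exact (mul_le_of_le_one_left (h.1 _) hφ).trans (hilb_le_opN h u x)

/-- The operator `ℓ₂ → ℂⁿ` whose transpose is `S`. -/
def pretranspose {n : ℕ} (S : ((Fin n → ℂ) →L[ℂ] ℂ) →L[ℂ] Hilb) : Hilb →L[ℂ] (Fin n → ℂ) :=
  ContinuousLinearMap.pi fun k => LinearMap.mkContinuous
    { toFun := fun x => inner ℂ (star x) (S (ContinuousLinearMap.proj k))
      map_add' := fun x y => by simp
      map_smul' := fun a x => by simp [mul_comm] } ‖S (ContinuousLinearMap.proj k)‖
    fun x => by
      simpa [mul_comm] using norm_inner_le_norm (𝕜 := ℂ) (star x) (S (ContinuousLinearMap.proj k))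

theorem eq_sum_proj {n : ℕ} (φ : (Fin n → ℂ) →L[ℂ] ℂ) :
    φ = ∑ k, φ (Pi.single k 1) • ContinuousLinearMap.proj (R := ℂ) (φ := fun _ : Fin n => ℂ) k := by
  ext x
  conv_lhs => rw [pi_eq_sum_univ' x, map_sum]
  simp only [map_smul, _root_.sum_apply, _root_.smul_apply,
    ContinuousLinearMap.proj_apply, smul_eq_mul]
  refine Finset.sum_congr rfl fun k _ => ?_
  rw [mul_comm]

theorem apply_pretranspose {n : ℕ} (S : ((Fin n → ℂ) →L[ℂ] ℂ) →L[ℂ] Hilb)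
    (φ : (Fin n → ℂ) →L[ℂ] ℂ) (x : Hilb) :
    φ (pretranspose S x) = inner ℂ (star x) (S φ) := by
  conv_lhs => rw [eq_sum_proj φ]
  conv_rhs => rw [eq_sum_proj φ]
  simp [pretranspose]

theorem transposeHilb_pretranspose {n : ℕ} (S : ((Fin n → ℂ) →L[ℂ] ℂ) →L[ℂ] Hilb) :
    transposeHilb (pretranspose S) = S := by
  ext1 φ
  refine hilb_ext_inner_star fun k => ?_
  rw [transposeHilb_apply, inner_star_hilbRiesz, ContinuousLinearMap.comp_apply,
    apply_pretranspose]

theorem opN_pretranspose_le {n : ℕ} {N : (Fin n → ℂ) → ℝ} (h : IsNormC N)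
    (S : ((Fin n → ℂ) →L[ℂ] ℂ) →L[ℂ] Hilb) :
    opN hilbNorm N (pretranspose S) ≤
      opN (fun φ : (Fin n → ℂ) →L[ℂ] ℂ => opN N (fun c : ℂ => ‖c‖) φ) hilbNorm S := by
  obtain ⟨C, hC, hle⟩ := h.le_norm
  have hb : ∀ φ : (Fin n → ℂ) →L[ℂ] ℂ, opN N (fun c : ℂ => ‖c‖) φ ≤ 1 →
      hilbNorm (S φ) ≤ ‖S‖ * C := fun φ hφ => by
    refine (S.le_opNorm φ).trans (mul_le_mul_of_nonneg_left ?_ (norm_nonneg S))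
    refine ContinuousLinearMap.opNorm_le_bound _ hC.le fun x => ?_
    exact (functional_le_opN h φ x).trans ((mul_le_of_le_one_left (h.1 _) hφ).trans (hle x))
  refine opN_le (opN_nonneg norm_nonneg) fun x hx => ?_
  obtain ⟨L, hL, hLx⟩ := h.exists_norming (pretranspose S x)
  set φ : (Fin n → ℂ) →L[ℂ] ℂ := LinearMap.toContinuousLinearMap L
  have hφ1 : opN N (fun c : ℂ => ‖c‖) φ ≤ 1 :=
    opN_le zero_le_one fun y hy => (hL y).trans hy
  have hval : N (pretranspose S x) = ‖φ (pretranspose S x)‖ := by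
    have : φ (pretranspose S x) = (N (pretranspose S x) : ℂ) := hLx
    rw [this, Complex.norm_real, Real.norm_of_nonneg (h.1 _)]
  rw [hval, apply_pretranspose]
  refine (norm_inner_le_norm _ _).trans ?_
  rw [norm_star]
  exact (mul_le_of_le_one_left (norm_nonneg _) hx).trans (le_opN_of_bound (T := S) hb hφ1)

end Transpose

section Gamma

variable {V W : Type*} [NormedAddCommGroup V] [NormedSpace ℂ V]
  [NormedAddCommGroup W] [NormedSpace ℂ W] {NV : V → ℝ} {NW : W → ℝ}

theorem gamma2_nonneg (hW : ∀ y, 0 ≤ NW y) (T : V →L[ℂ] W) : 0 ≤ gamma2 NV NW T :=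
  Real.sInf_nonneg (by
    rintro _ ⟨S, R, -, rfl⟩
    exact mul_nonneg (opN_nonneg norm_nonneg) (opN_nonneg hW))

theorem gamma2_comp_le (hW : ∀ y, 0 ≤ NW y) (S : V →L[ℂ] Hilb) (R : Hilb →L[ℂ] W) :
    gamma2 NV NW (R.comp S) ≤ opN NV hilbNorm S * opN hilbNorm NW R := by
  refine csInf_le ⟨0, ?_⟩ ⟨S, R, rfl, rfl⟩
  rintro _ ⟨S, R, -, rfl⟩
  exact mul_nonneg (opN_nonneg norm_nonneg) (opN_nonneg hW)

theorem exists_factorization {n : ℕ} (T : ((Fin n → ℂ) →L[ℂ] ℂ) →L[ℂ] W) :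
    ∃ (S : ((Fin n → ℂ) →L[ℂ] ℂ) →L[ℂ] Hilb) (R : Hilb →L[ℂ] W), R.comp S = T := by
  let e : Fin n → Hilb := fun k => lp.single 2 (k : ℕ) (1 : ℂ)
  let S : ((Fin n → ℂ) →L[ℂ] ℂ) →L[ℂ] Hilb :=
    ∑ k, (ContinuousLinearMap.apply ℂ ℂ (Pi.single k 1 : Fin n → ℂ)).smulRight (e k)
  let R : Hilb →L[ℂ] W :=
    ∑ k, (innerSL ℂ (e k)).smulRight (T (ContinuousLinearMap.proj k))
  refine ⟨S, R, ?_⟩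
  have he : ∀ i j : Fin n, inner ℂ (e i) (e j) = if i = j then (1 : ℂ) else 0 := fun i j => by
    simp [e, lp.inner_single_left, Pi.single_apply, Fin.ext_iff]
  ext1 φ
  conv_rhs => rw [eq_sum_proj φ]
  simp [S, R, he]

end Gamma

/-- Bilinear interpolation of `(u, v) ↦ v ∘ u'`. -/
theorem InterpBound.comp_transpose {V W : Type*} [NormedAddCommGroup V] [NormedSpace ℂ V]
    [FiniteDimensional ℂ V] [NormedAddCommGroup W] [NormedSpace ℂ W] {θ : ℝ}
    {NV₀ NV₁ : V → ℝ} {NW₀ NW₁ : W → ℝ} (hV₀ : IsNormC NV₀) (hV₁ : IsNormC NV₁)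
    (hW₀ : IsNormC NW₀) (hW₁ : IsNormC NW₁) {ι κ : Type*} [Fintype ι] [Fintype κ]
    {u : Hilb →L[ℂ] V} {v : Hilb →L[ℂ] W} {a b : ℝ}
    (hu : InterpBound θ (fun S : Hilb →L[ℂ] V => opN hilbNorm NV₀ S)
      (fun S : Hilb →L[ℂ] V => opN hilbNorm NV₁ S) ι u a)
    (hv : InterpBound θ (fun S : Hilb →L[ℂ] W => opN hilbNorm NW₀ S)
      (fun S : Hilb →L[ℂ] W => opN hilbNorm NW₁ S) κ v b) :
    InterpBound θ
      (fun T : (V →L[ℂ] ℂ) →L[ℂ] W =>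
        gamma2 (fun φ : V →L[ℂ] ℂ => opN NV₀ (fun c : ℂ => ‖c‖) ⇑φ) NW₀ T)
      (fun T : (V →L[ℂ] ℂ) →L[ℂ] W =>
        gamma2 (fun φ : V →L[ℂ] ℂ => opN NV₁ (fun c : ℂ => ‖c‖) ⇑φ) NW₁ T)
      (ι × κ) (v.comp (transposeHilb u)) (a * b) := by
  have ha : 0 ≤ a := hu.nonneg fun _ => opN_nonneg hV₀.1
  obtain ⟨φ, x, h1, h2, h3, rfl, h5, h6⟩ := hu
  obtain ⟨ψ, y, k1, k2, k3, rfl, k5, k6⟩ := hv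
  have hs : ∀ z, ∑ p : ι × κ, (φ p.1 z * ψ p.2 z) • (y p.2).comp (transposeHilb (x p.1)) =
      (∑ j, ψ j z • y j).comp (transposeHilb (∑ i, φ i z • x i)) := fun z => by
    ext1 χ
    simp only [Fintype.sum_prod_type, map_sum, map_smul, ContinuousLinearMap.comp_apply,
      _root_.sum_apply, _root_.smul_apply, Finset.smul_sum, smul_smul]
  have hbd : ∀ {NV : V → ℝ} {NW : W → ℝ} (_ : IsNormC NV) (_ : IsNormC NW)
      {p : Hilb →L[ℂ] V} {q : Hilb →L[ℂ] W}, opN hilbNorm NV p ≤ a → opN hilbNorm NW q ≤ b →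
      gamma2 (fun φ : V →L[ℂ] ℂ => opN NV (fun c : ℂ => ‖c‖) ⇑φ) NW
        (q.comp (transposeHilb p)) ≤ a * b := fun hV hW _ _ hp hq =>
    (gamma2_comp_le hW.1 _ _).trans
      (mul_le_mul ((opN_transposeHilb_le hV _).trans hp) hq (opN_nonneg hW.1) ha)
  refine ⟨fun p z => φ p.1 z * ψ p.2 z, fun p => (y p.2).comp (transposeHilb (x p.1)),
    fun p => (h1 _).mul (k1 _), fun p => (h2 _).mul (k2 _), fun p => ?_, hs _, fun t => ?_,
    fun t => ?_⟩
  · obtain ⟨A, hA⟩ := h3 p.1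
    obtain ⟨B, hB⟩ := k3 p.2
    refine ⟨A * B, fun z hz => ?_⟩
    rw [norm_mul]
    exact mul_le_mul (hA z hz) (hB z hz) (norm_nonneg _) ((norm_nonneg _).trans (hA z hz))
  · simp only [hs]
    exact hbd hV₀ hW₀ (h5 t) (k5 t)
  · simp only [hs]
    exact hbd hV₁ hW₁ (h6 t) (k6 t)

/-- the embedding
`Γ₂([E₀,E₁]_θ',[F₀,F₁]_θ) → [Γ₂(E₀',F₀),Γ₂(E₁',F₁)]_θ` has norm at most
`d_θ[E₀,E₁]·d_θ[F₀,F₁]`. -/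
theorem statement11 {n m : ℕ} (θ : ℝ) (hθ : 0 < θ) (hθ1 : θ < 1)
    (NE₀ NE₁ : (Fin n → ℂ) → ℝ) (NF₀ NF₁ : (Fin m → ℂ) → ℝ)
    (hE₀ : IsNormC NE₀) (hE₁ : IsNormC NE₁)
    (hF₀ : IsNormC NF₀) (hF₁ : IsNormC NF₁)
    (T : ((Fin n → ℂ) →L[ℂ] ℂ) →L[ℂ] (Fin m → ℂ)) :
    interpN θ
      (fun T' : ((Fin n → ℂ) →L[ℂ] ℂ) →L[ℂ] (Fin m → ℂ) =>
        gamma2 (fun φ : (Fin n → ℂ) →L[ℂ] ℂ => opN NE₀ (fun c : ℂ => ‖c‖) ⇑φ) NF₀ T')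
      (fun T' : ((Fin n → ℂ) →L[ℂ] ℂ) →L[ℂ] (Fin m → ℂ) =>
        gamma2 (fun φ : (Fin n → ℂ) →L[ℂ] ℂ => opN NE₁ (fun c : ℂ => ‖c‖) ⇑φ) NF₁ T') T ≤
      dTheta θ NE₀ NE₁ * dTheta θ NF₀ NF₁ *
        gamma2 (fun φ : (Fin n → ℂ) →L[ℂ] ℂ =>
            opN (interpN θ NE₀ NE₁) (fun c : ℂ => ‖c‖) ⇑φ)
          (interpN θ NF₀ NF₁) T := by
  have hEn := isNormC_interpN hθ.le hθ1.le hE₀ hE₁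
  have hFn := isNormC_interpN hθ.le hθ1.le hF₀ hF₁
  have hdE : 0 ≤ dTheta θ NE₀ NE₁ := dTheta_nonneg hE₀
  have hdF : 0 ≤ dTheta θ NF₀ NF₁ := dTheta_nonneg hF₀
  rw [gamma2, ← smul_eq_mul, ← Real.sInf_smul_of_nonneg (mul_nonneg hdE hdF)]
  refine le_csInf ?_ ?_
  · obtain ⟨S, R, hT⟩ := exists_factorization T
    exact Set.Nonempty.smul_set ⟨_, S, R, hT, rfl⟩
  rintro _ ⟨_, ⟨S, R, rfl, rfl⟩, rfl⟩
  set α := dTheta θ NE₀ NE₁ *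
    opN (fun φ : (Fin n → ℂ) →L[ℂ] ℂ => opN (interpN θ NE₀ NE₁) (fun c : ℂ => ‖c‖) φ) hilbNorm S
  set β := dTheta θ NF₀ NF₁ * opN hilbNorm (interpN θ NF₀ NF₁) R
  have hu := (interpN_le_dTheta_mul hθ.le hθ1.le hE₀ hE₁ (pretranspose S)).trans
    (mul_le_mul_of_nonneg_left (opN_pretranspose_le hEn S) hdE)
  have hv := interpN_le_dTheta_mul hθ.le hθ1.le hF₀ hF₁ R
  have hβ : 0 ≤ β := mul_nonneg hdF (opN_nonneg hFn.1)
  refine le_of_le_of_eq (b := α * β) ?_ (by simp only [α, β, smul_eq_mul]; ring)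
  refine ge_of_tendsto (f := fun ε => (α + ε) * (β + ε)) (x := nhdsWithin 0 (Set.Ioi 0)) ?_
    (Filter.eventually_of_mem self_mem_nhdsWithin fun ε hε => ?_)
  · have : Continuous fun ε : ℝ => (α + ε) * (β + ε) := by fun_prop
    simpa using (this.tendsto 0).mono_left nhdsWithin_le_nhds
  have hε : 0 < ε := hε
  obtain ⟨_, a, ha, hua⟩ := exists_interpBound (hu.trans_lt (lt_add_of_pos_right α hε))
  obtain ⟨_, b, hb, hvb⟩ := exists_interpBound (hv.trans_lt (lt_add_of_pos_right β hε))
  have key := interpN_le (fun _ => gamma2_nonneg hF₀.1 _)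
    (hua.comp_transpose hE₀ hE₁ hF₀ hF₁ hvb)
  rw [transposeHilb_pretranspose] at key
  exact key.trans (mul_le_mul ha.le hb.le (hvb.nonneg fun _ => opN_nonneg hF₀.1)
    ((hua.nonneg fun _ => opN_nonneg hE₀.1).trans ha.le))

end Paper
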